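/- Under Assumptions A1–A4 and the stated conditions on h and Γ, there exists a constant C > 0, depending only on T, τ, r, ξ, L₀ and the constants in Assumptions A1–A4 (but not on Δ or K), such that for every admissible step size Δ ∈ (0,1] and every K > ‖ξ‖: P( sup_{0 ≤ t ≤ T} |χ(t)| ≥ K ) ≤ C/K², where χ is the continuous version of the truncated Euler–Maruyama scheme; equivalently, the stopping time ρ_{Δ,K} = inf{ t ∈ [0,T] : |χ(t)| ≥ K } satisfies P(ρ_{Δ,K} ≤ T) ≤ C/K². -/

import Mathlib

open MeasureTheory ProbabilityTheory

theorem mul_measureReal_add_setIntegral_diff_le {Ω : Type*} [MeasurableSpace Ω] {μ : Measure Ω}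
    [IsFiniteMeasure μ] {Z : Ω → ℝ} (hZ : Measurable Z) (hZi : Integrable Z μ) {G : Set Ω}
    (hG : MeasurableSet G) (lam : ℝ) :
    lam * μ.real (G ∩ {ω | lam ≤ Z ω}) + ∫ ω in G \ {ω | lam ≤ Z ω}, Z ω ∂μ
      ≤ ∫ ω in G, Z ω ∂μ := by
  have hm : MeasurableSet {ω | lam ≤ Z ω} := measurableSet_le measurable_const hZ
  have hsum := integral_inter_add_sdiff hm (hZi.integrableOn (s := G))
  have := setIntegral_ge_of_const_le (hG.inter hm) (measure_ne_top μ _) (fun x hx => hx.2)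
    hZi.integrableOn
  rw [smul_eq_mul, mul_comm] at this
  linarith

/-- A maximal inequality for nonnegative processes whose integrals over past events grow by at
most `c` in each step. -/
theorem mul_measureReal_exists_ge_le {Ω : Type*} {m0 : MeasurableSpace Ω} {μ : Measure Ω}
    [IsFiniteMeasure μ] {Z : ℕ → Ω → ℝ} {F : ℕ → MeasurableSpace Ω} (hFmono : Monotone F)
    (hF : ∀ n, F n ≤ m0) {N : ℕ} (hZnn : ∀ n ω, 0 ≤ Z n ω)
    (hZm : ∀ n ≤ N, Measurable[F n] (Z n)) (hZi : ∀ n ≤ N, Integrable (Z n) μ) {c : ℝ}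
    (hstep : ∀ n < N, ∀ G, MeasurableSet[F n] G →
      ∫ ω in G, Z (n + 1) ω ∂μ ≤ ∫ ω in G, Z n ω ∂μ + c) (lam : ℝ) :
    lam * μ.real {ω | ∃ i ≤ N, lam ≤ Z i ω} ≤ ∫ ω, Z 0 ω ∂μ + N * c := by
  have hmeas : ∀ n ≤ N, MeasurableSet[F n] {ω | ∃ i ≤ n, lam ≤ Z i ω} := by
    intro n hn
    have : {ω | ∃ i ≤ n, lam ≤ Z i ω} = ⋃ i ∈ Set.Iic n, {ω | lam ≤ Z i ω} := by
      ext ω; simp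
    rw [this]
    refine MeasurableSet.biUnion (Set.to_countable _) fun i hi => ?_
    exact hFmono hi _ (hZm i (le_trans hi hn) measurableSet_Ici)
  have key : ∀ n ≤ N, lam * μ.real {ω | ∃ i ≤ n, lam ≤ Z i ω}
      + ∫ ω in {ω | ∃ i ≤ n, lam ≤ Z i ω}ᶜ, Z n ω ∂μ ≤ ∫ ω, Z 0 ω ∂μ + n * c := by
    intro n
    induction n with
    | zero =>
      intro h0
      have := mul_measureReal_add_setIntegral_diff_le ((hZm 0 h0).mono (hF 0) le_rfl)
        (hZi 0 h0) MeasurableSet.univ lam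
      simpa [Set.compl_eq_univ_sdiff] using this
    | succ n ih =>
      intro hn
      have h1 := ih (by omega)
      have hGm := (hmeas n (by omega)).compl
      have h2 := hstep n (by omega) _ hGm
      have h3 := mul_measureReal_add_setIntegral_diff_le
        ((hZm (n + 1) hn).mono (hF _) le_rfl) (hZi (n + 1) hn) (hF n _ hGm) lam
      set E := {ω | ∃ i ≤ n, lam ≤ Z i ω} with hE
      have hsplit : {ω | ∃ i ≤ n + 1, lam ≤ Z i ω} = E ∪ (Eᶜ ∩ {ω | lam ≤ Z (n + 1) ω}) := by
        ext ω
        simp only [hE, Set.mem_ofPred_eq, Set.mem_union, Set.mem_inter_iff, Set.mem_compl_iff]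
        constructor
        · rintro ⟨i, hi, h⟩
          by_cases hc : ∃ i ≤ n, lam ≤ Z i ω
          · exact Or.inl hc
          · rcases Nat.le_succ_iff.1 hi with h' | h'
            · exact Or.inl ⟨i, h', h⟩
            · subst h'; exact Or.inr ⟨hc, h⟩
        · rintro (⟨i, hi, h⟩ | ⟨_, h⟩)
          · exact ⟨i, by omega, h⟩
          · exact ⟨n + 1, le_rfl, h⟩
      have hcompl : {ω | ∃ i ≤ n + 1, lam ≤ Z i ω}ᶜ = Eᶜ \ {ω | lam ≤ Z (n + 1) ω} := by
        rw [hsplit, Set.compl_union, Set.sdiff_eq]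
        ext ω; simp; tauto
      have hreal : μ.real {ω | ∃ i ≤ n + 1, lam ≤ Z i ω}
          = μ.real E + μ.real (Eᶜ ∩ {ω | lam ≤ Z (n + 1) ω}) := by
        rw [hsplit]
        refine measureReal_union ?_ ?_
        · exact Set.disjoint_left.2 fun ω h h' => h'.1 h
        · exact (hF n _ hGm).inter
            (measurableSet_le measurable_const ((hZm (n + 1) hn).mono (hF _) le_rfl))
      rw [hcompl, hreal]
      push_cast
      linarith
  have h := key N le_rfl
  have h0 : 0 ≤ ∫ ω in {ω | ∃ i ≤ N, lam ≤ Z i ω}ᶜ, Z N ω ∂μ :=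
    integral_nonneg fun ω => hZnn N ω
  linarith

theorem sq_step_le {X a b W D P s δ ρ q : ℝ} (hs : 0 ≤ s) (hδ : 0 ≤ δ) (hsδ : s + δ ≤ ρ ^ 2)
    (hρ : 0 < ρ) (hρ1 : ρ ≤ 1) (hq : b ^ 2 * ρ ≤ q) (haP : a ^ 2 * ρ ≤ P)
    (hP : 2 * X * a + b ^ 2 ≤ P) :
    (X + a * (s + δ) + b * (W + D)) ^ 2 ≤ (X + a * s + b * W) ^ 2
      + δ * (5 * P + q / ρ ^ 2 * W ^ 2) + b ^ 2 * (D ^ 2 - δ)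
      + 2 * (X + a * s + b * W + a * δ) * b * D := by
  have h1 : 2 * (a * b * W) ≤ ρ * a ^ 2 + q / ρ ^ 2 * W ^ 2 := by
    have : b ^ 2 / ρ ≤ q / ρ ^ 2 := by
      rw [div_le_div_iff₀ hρ (by positivity)]
      nlinarith
    have h2 : b ^ 2 / ρ * W ^ 2 ≤ q / ρ ^ 2 * W ^ 2 := by gcongr
    have h3 : 2 * (a * b * W) ≤ ρ * a ^ 2 + b ^ 2 / ρ * W ^ 2 := by
      have : 0 ≤ (ρ * a - b * W) ^ 2 / ρ := by positivity
      have e : (ρ * a - b * W) ^ 2 / ρ = ρ * a ^ 2 - 2 * (a * b * W) + b ^ 2 / ρ * W ^ 2 := by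
        field_simp
        ring
      linarith
    linarith
  have hsq : ρ ^ 2 ≤ ρ := by nlinarith
  have h4 : 2 * a ^ 2 * s + a ^ 2 * δ ≤ 3 * P := by
    have : a ^ 2 * (s + δ) ≤ a ^ 2 * ρ := by gcongr; linarith
    nlinarith [mul_nonneg (sq_nonneg a) hs, mul_nonneg (sq_nonneg a) hδ]
  have h5 : 2 * X * a + 2 * a ^ 2 * s + a ^ 2 * δ + 2 * (a * b * W) + b ^ 2
      ≤ 5 * P + q / ρ ^ 2 * W ^ 2 := by linarith
  have h6 := mul_le_mul_of_nonneg_left h5 hδ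
  nlinarith [h6]

/-- One step of size `δ` with frozen coefficients: over a past event the second moment grows by
at most a constant times `δ`. -/
theorem setIntegral_sq_step_le {Ω : Type*} {m m0 : MeasurableSpace Ω} {μ : Measure Ω}
    [IsProbabilityMeasure μ] (hm : m ≤ m0) {X a b W D P : Ω → ℝ} {s δ ρ q bmax : ℝ}
    (hX : Measurable[m] X) (ha : Measurable[m] a) (hb : Measurable[m] b) (hW : Measurable[m] W)
    (hD : Measurable D) (hX2 : MemLp X 2 μ) (ha2 : MemLp a 2 μ) (hbb : ∀ ω, |b ω| ≤ bmax)
    (hW2 : MemLp W 2 μ) (hD2 : MemLp D 2 μ) (hPi : Integrable P μ)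
    (hind : Indep (MeasurableSpace.comap D inferInstance) m μ)
    (hDmean : ∫ ω, D ω ∂μ = 0) (hDsq : ∫ ω, D ω ^ 2 ∂μ = δ) (hWsq : ∫ ω, W ω ^ 2 ∂μ ≤ ρ ^ 2)
    (hs : 0 ≤ s) (hδ : 0 ≤ δ) (hsδ : s + δ ≤ ρ ^ 2) (hρ : 0 < ρ) (hρ1 : ρ ≤ 1)
    (hq0 : 0 ≤ q) (hq : ∀ ω, b ω ^ 2 * ρ ≤ q) (haP : ∀ ω, a ω ^ 2 * ρ ≤ P ω)
    (hP : ∀ ω, 2 * X ω * a ω + b ω ^ 2 ≤ P ω) {G : Set Ω} (hG : MeasurableSet[m] G) :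
    ∫ ω in G, (X ω + a ω * (s + δ) + b ω * (W ω + D ω)) ^ 2 ∂μ
      ≤ ∫ ω in G, (X ω + a ω * s + b ω * W ω) ^ 2 ∂μ + δ * (5 * ∫ ω, P ω ∂μ + q) := by
  have hb0 : AEStronglyMeasurable b μ := (hb.mono hm le_rfl).aestronglyMeasurable
  have hbd : ∀ {f : Ω → ℝ}, MemLp f 2 μ → MemLp (fun ω => b ω * f ω) 2 μ := by
    intro f hf
    refine (hf.const_mul bmax).of_le (hb0.mul hf.1) (ae_of_all _ fun ω => ?_)
    rw [norm_mul, norm_mul]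
    gcongr
    exact (hbb ω).trans (le_abs_self _)
  have hY : MemLp (fun ω => X ω + a ω * s + b ω * W ω) 2 μ :=
    (hX2.add (by simpa [mul_comm] using ha2.const_mul s)).add (hbd hW2)
  have hV : MemLp (fun ω => X ω + a ω * s + b ω * W ω + a ω * δ) 2 μ :=
    hY.add (by simpa [mul_comm] using ha2.const_mul δ)
  have hY' : MemLp (fun ω => X ω + a ω * (s + δ) + b ω * (W ω + D ω)) 2 μ :=
    (hX2.add (by simpa [mul_comm] using ha2.const_mul (s + δ))).add (hbd (hW2.add hD2))
  have hG0 : MeasurableSet G := hm _ hG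
  have hI1 : Integrable (fun ω => δ * (5 * P ω + q / ρ ^ 2 * W ω ^ 2)) μ :=
    ((hPi.const_mul 5).add (hW2.integrable_sq.const_mul _)).const_mul δ
  have hb2 : Integrable (fun ω => b ω ^ 2) μ := by
    have h1 : MemLp (fun ω => b ω * (1 : ℝ)) 2 μ := hbd (memLp_const 1)
    simpa using h1.integrable_sq
  have hI2 : Integrable (fun ω => b ω ^ 2 * (D ω ^ 2 - δ)) μ := by
    have h1 := (hbd hD2).integrable_sq.sub (hb2.const_mul δ)
    refine h1.congr (ae_of_all _ fun ω => ?_)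
    simp only [Pi.sub_apply]; ring
  have hI3 : Integrable (fun ω => 2 * (X ω + a ω * s + b ω * W ω + a ω * δ) * b ω * D ω) μ := by
    have h1 := (hV.integrable_mul (hbd hD2)).const_mul 2
    refine h1.congr (ae_of_all _ fun ω => ?_)
    simp only [Pi.mul_apply]; ring
  have hfac : ∀ {f : Ω → ℝ} {g : ℝ → ℝ}, Measurable[m] f → Measurable g →
      ∫ ω in G, f ω * g (D ω) ∂μ = (∫ ω in G, f ω ∂μ) * ∫ ω, g (D ω) ∂μ := by
    intro f g hf hg
    rw [← integral_indicator hG0, ← integral_indicator hG0]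
    have hfm : Measurable[m] (G.indicator f) := hf.indicator hG
    have hI : IndepFun (G.indicator f) (fun ω => g (D ω)) μ := by
      rw [IndepFun_iff_Indep]
      refine Indep.symm (indep_of_indep_of_le_left (indep_of_indep_of_le_right hind
        hfm.comap_le) ?_)
      rintro _ ⟨t, ht, rfl⟩
      exact ⟨g ⁻¹' t, hg ht, rfl⟩
    rw [← hI.integral_fun_mul_eq_mul_integral (hfm.mono hm le_rfl).aestronglyMeasurable
      (hg.comp hD).aestronglyMeasurable]
    congr 1
    ext ω
    by_cases h : ω ∈ G <;> simp [h]
  have e2 : ∫ ω in G, b ω ^ 2 * (D ω ^ 2 - δ) ∂μ = 0 := by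
    rw [hfac (g := fun x => x ^ 2 - δ) (hb.pow_const 2) (by fun_prop)]
    rw [integral_sub hD2.integrable_sq (integrable_const _), hDsq]
    simp
  have e3 : ∫ ω in G, 2 * (X ω + a ω * s + b ω * W ω + a ω * δ) * b ω * D ω ∂μ = 0 := by
    rw [hfac (f := fun ω => 2 * (X ω + a ω * s + b ω * W ω + a ω * δ) * b ω) (g := fun x => x)
      (by fun_prop) measurable_id, hDmean, mul_zero]
  have hI12 : Integrable (fun ω => (X ω + a ω * s + b ω * W ω) ^ 2
      + δ * (5 * P ω + q / ρ ^ 2 * W ω ^ 2)) μ := hY.integrable_sq.add hI1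
  have hI123 : Integrable (fun ω => (X ω + a ω * s + b ω * W ω) ^ 2
      + δ * (5 * P ω + q / ρ ^ 2 * W ω ^ 2) + b ω ^ 2 * (D ω ^ 2 - δ)) μ := hI12.add hI2
  have hPnn : ∀ ω, 0 ≤ P ω := fun ω => le_trans (by positivity) (haP ω)
  have e1 : ∫ ω in G, δ * (5 * P ω + q / ρ ^ 2 * W ω ^ 2) ∂μ ≤ δ * (5 * ∫ ω, P ω ∂μ + q) := by
    refine (setIntegral_le_integral hI1 (ae_of_all _ fun ω => ?_)).trans ?_
    · have := hPnn ω
      simp only [Pi.zero_apply]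
      positivity
    · rw [integral_const_mul, integral_add (hPi.const_mul 5) (hW2.integrable_sq.const_mul _),
        integral_const_mul, integral_const_mul]
      gcongr
      calc q / ρ ^ 2 * ∫ ω, W ω ^ 2 ∂μ ≤ q / ρ ^ 2 * ρ ^ 2 := by gcongr
        _ = q := by field_simp
  calc ∫ ω in G, (X ω + a ω * (s + δ) + b ω * (W ω + D ω)) ^ 2 ∂μ
      ≤ ∫ ω in G, ((X ω + a ω * s + b ω * W ω) ^ 2
        + δ * (5 * P ω + q / ρ ^ 2 * W ω ^ 2) + b ω ^ 2 * (D ω ^ 2 - δ)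
        + 2 * (X ω + a ω * s + b ω * W ω + a ω * δ) * b ω * D ω) ∂μ := by
        refine setIntegral_mono hY'.integrable_sq.integrableOn
          (hI123.add hI3).integrableOn fun ω => ?_
        exact sq_step_le hs hδ hsδ hρ hρ1 (hq ω) (haP ω) (hP ω)
    _ = ∫ ω in G, (X ω + a ω * s + b ω * W ω) ^ 2 ∂μ
        + ∫ ω in G, δ * (5 * P ω + q / ρ ^ 2 * W ω ^ 2) ∂μ
        + ∫ ω in G, b ω ^ 2 * (D ω ^ 2 - δ) ∂μ
        + ∫ ω in G, 2 * (X ω + a ω * s + b ω * W ω + a ω * δ) * b ω * D ω ∂μ := by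
        rw [integral_add hI123.integrableOn hI3.integrableOn,
          integral_add hI12.integrableOn hI2.integrableOn,
          integral_add hY.integrable_sq.integrableOn hI1.integrableOn]
    _ ≤ _ := by rw [e2, e3]; linarith

theorem moments_of_map_eq_gaussianReal {Ω : Type*} [MeasurableSpace Ω] {μ : Measure Ω} {D : Ω → ℝ}
    (hD : Measurable D) {v : NNReal} (h : μ.map D = gaussianReal 0 v) :
    MemLp D 2 μ ∧ ∫ ω, D ω ∂μ = 0 ∧ ∫ ω, D ω ^ 2 ∂μ = v := by
  refine ⟨?_, ?_, ?_⟩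
  · have := memLp_id_gaussianReal (μ := 0) (v := v) 2
    rw [← h, memLp_map_measure_iff aestronglyMeasurable_id hD.aemeasurable] at this
    exact this
  · rw [← integral_map (f := fun x : ℝ => x) hD.aemeasurable (by fun_prop), h,
      integral_id_gaussianReal]
  · rw [← integral_map (f := fun x : ℝ => x ^ 2) hD.aemeasurable (by fun_prop), h,
      ← variance_of_integral_eq_zero (X := fun x : ℝ => x) (by fun_prop) integral_id_gaussianReal,
      variance_fun_id_gaussianReal]

/-- The σ-algebra generated by `B u` for `0 ≤ u ≤ s`. -/
@[reducible] def pastSigma {Ω : Type*} (B : ℝ → Ω → ℝ) (s : ℝ) : MeasurableSpace Ω :=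
  MeasurableSpace.comap (fun ω (u : Set.Icc (0 : ℝ) s) => B (u : ℝ) ω) MeasurableSpace.pi

theorem measurable_pastSigma {Ω : Type*} (B : ℝ → Ω → ℝ) {s u : ℝ} (h0 : 0 ≤ u) (hu : u ≤ s) :
    Measurable[pastSigma B s] (B u) :=
  (measurable_pi_apply (X := fun _ : Set.Icc (0 : ℝ) s => ℝ) ⟨u, h0, hu⟩).comp
    (comap_measurable fun ω (u : Set.Icc (0 : ℝ) s) => B (u : ℝ) ω)

theorem pastSigma_mono {Ω : Type*} (B : ℝ → Ω → ℝ) : Monotone (pastSigma B) := by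
  intro s t hst
  refine Measurable.comap_le ?_
  exact @measurable_pi_lambda _ _ _ (pastSigma B t) _ _
    fun u => measurable_pastSigma B u.2.1 (u.2.2.trans hst)

theorem pastSigma_le {Ω : Type*} [m0 : MeasurableSpace Ω] {B : ℝ → Ω → ℝ}
    (hB : ∀ t, Measurable (B t)) (s : ℝ) : pastSigma B s ≤ m0 :=
  Measurable.comap_le (measurable_pi_lambda _ fun u => hB u)

/-- The process has centred Gaussian increments which are independent of the past. -/
structure HasIndepGaussianIncrements {Ω : Type*} [MeasurableSpace Ω] (B : ℝ → Ω → ℝ)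
    (μ : Measure Ω) : Prop where
  measurable : ∀ t, Measurable (B t)
  map_sub : ∀ s t : ℝ, 0 ≤ s → s ≤ t →
    Measure.map (fun ω => B t ω - B s ω) μ = gaussianReal 0 (Real.toNNReal (t - s))
  indep : ∀ s t : ℝ, 0 ≤ s → s ≤ t →
    Indep (MeasurableSpace.comap (fun ω => B t ω - B s ω) inferInstance) (pastSigma B s) μ

namespace HasIndepGaussianIncrements

variable {Ω : Type*} [MeasurableSpace Ω] {B : ℝ → Ω → ℝ} {μ : Measure Ω}

theorem moments (hB : HasIndepGaussianIncrements B μ) {s t : ℝ} (hs : 0 ≤ s) (hst : s ≤ t) :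
    MemLp (fun ω => B t ω - B s ω) 2 μ ∧ ∫ ω, (B t ω - B s ω) ∂μ = 0 ∧
      ∫ ω, (B t ω - B s ω) ^ 2 ∂μ = t - s := by
  have h := moments_of_map_eq_gaussianReal ((hB.measurable t).sub (hB.measurable s))
    (hB.map_sub s t hs hst)
  rwa [Real.coe_toNNReal _ (sub_nonneg.2 hst)] at h

end HasIndepGaussianIncrements

/-- Bounds on the (truncated) delay drift `a` and diffusion coefficient `b` for the step size
`ρ ^ 2`. The coordinate `i₀` is the one with zero delay. -/
structure TruncatedCoeffBounds {r : ℕ} (a : (Fin r → ℝ) → ℝ) (b : ℝ → ℝ) (i₀ : Fin r)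
    (ρ κ q amax bmax : ℝ) : Prop where
  pos : 0 < ρ
  le_one : ρ ≤ 1
  measurable_drift : Measurable a
  measurable_diff : Measurable b
  abs_drift_le : ∀ m, |a m| ≤ amax * (1 + ∑ i, |m i|)
  abs_diff_le : ∀ x, |b x| ≤ bmax
  sq_diff_le : ∀ x, b x ^ 2 * ρ ≤ q
  sq_drift_le : ∀ m, a m ^ 2 * ρ ≤ κ * (1 + ∑ i, m i ^ 2)
  coercive : ∀ m, 2 * m i₀ * a m + b (m i₀) ^ 2 ≤ κ * (1 + ∑ i, m i ^ 2)

/-- Euler–Maruyama extrapolation from time `t₀` with coefficients frozen at the delayed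
values `Y`. -/
def frozenEM {Ω : Type*} {r : ℕ} (a : (Fin r → ℝ) → ℝ) (b : ℝ → ℝ) (i₀ : Fin r)
    (B : ℝ → Ω → ℝ) (Y : Fin r → Ω → ℝ) (t₀ t : ℝ) (ω : Ω) : ℝ :=
  Y i₀ ω + a (fun v => Y v ω) * (t - t₀) + b (Y i₀ ω) * (B t ω - B t₀ ω)

section FrozenStep

variable {Ω : Type*} [m0 : MeasurableSpace Ω] {μ : Measure Ω} [IsProbabilityMeasure μ]
  {B : ℝ → Ω → ℝ} {r : ℕ} {a : (Fin r → ℝ) → ℝ} {b : ℝ → ℝ} {i₀ : Fin r}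
  {ρ κ q amax bmax : ℝ} {Y : Fin r → Ω → ℝ} {t₀ : ℝ}

theorem TruncatedCoeffBounds.nonneg (hc : TruncatedCoeffBounds a b i₀ ρ κ q amax bmax) :
    0 ≤ κ ∧ 0 ≤ q := by
  constructor
  · have h := (mul_nonneg (sq_nonneg (a 0)) hc.pos.le).trans (hc.sq_drift_le 0)
    simpa using h
  · exact (mul_nonneg (sq_nonneg (b 0)) hc.pos.le).trans (hc.sq_diff_le 0)

theorem TruncatedCoeffBounds.memLp_drift (hc : TruncatedCoeffBounds a b i₀ ρ κ q amax bmax)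
    (hYm : ∀ v, Measurable (Y v)) (hY2 : ∀ v, MemLp (Y v) 2 μ) :
    MemLp (fun ω => a fun v => Y v ω) 2 μ := by
  have hsum : MemLp (fun ω => ∑ v, |Y v ω|) 2 μ := memLp_finsetSum _ fun v _ => (hY2 v).norm
  have h : MemLp (fun ω => amax * (1 + ∑ v, |Y v ω|)) 2 μ :=
    MemLp.const_mul ((memLp_const (1 : ℝ)).add hsum) amax
  exact h.mono' (hc.measurable_drift.comp (measurable_pi_lambda _ hYm)).aestronglyMeasurable
    (ae_of_all _ fun ω => hc.abs_drift_le _)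

theorem frozenEM_measurable_memLp (hB : HasIndepGaussianIncrements B μ)
    (hc : TruncatedCoeffBounds a b i₀ ρ κ q amax bmax) (ht₀ : 0 ≤ t₀)
    (hYm : ∀ v, Measurable[pastSigma B t₀] (Y v)) (hY2 : ∀ v, MemLp (Y v) 2 μ) {t : ℝ}
    (ht : t₀ ≤ t) :
    Measurable[pastSigma B t] (frozenEM a b i₀ B Y t₀ t) ∧
      MemLp (frozenEM a b i₀ B Y t₀ t) 2 μ := by
  have hYt : ∀ v, Measurable[pastSigma B t] (Y v) :=
    fun v => (hYm v).mono (pastSigma_mono B ht) le_rfl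
  have hY0 : ∀ v, Measurable (Y v) := fun v => (hYm v).mono (pastSigma_le hB.measurable _) le_rfl
  have hBt := measurable_pastSigma B (ht₀.trans ht) le_rfl
  have hBt₀ := measurable_pastSigma B ht₀ ht
  have hb := hc.measurable_diff
  have ha := hc.measurable_drift
  constructor
  · have h1 : Measurable[pastSigma B t] (fun ω => a fun v => Y v ω) :=
      ha.comp (@measurable_pi_lambda _ _ _ (pastSigma B t) _ _ hYt)
    have h2 : Measurable[pastSigma B t] (fun ω => b (Y i₀ ω)) := hb.comp (hYt i₀)
    exact ((hYt i₀).add (h1.mul_const _)).add (h2.mul (hBt.sub hBt₀))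
  · refine ((hY2 i₀).add (by simpa [mul_comm] using
      (hc.memLp_drift hY0 hY2).const_mul (t - t₀))).add ?_
    refine ((hB.moments ht₀ ht).1.const_mul bmax).of_le ?_ (ae_of_all _ fun ω => ?_)
    · exact ((hb.comp (hY0 i₀)).mul
        ((hB.measurable t).sub (hB.measurable t₀))).aestronglyMeasurable
    · rw [norm_mul, norm_mul]
      gcongr
      exact (hc.abs_diff_le _).trans (le_abs_self _)

theorem setIntegral_sq_frozenEM_le (hB : HasIndepGaussianIncrements B μ)
    (hc : TruncatedCoeffBounds a b i₀ ρ κ q amax bmax) (ht₀ : 0 ≤ t₀)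
    (hYm : ∀ v, Measurable[pastSigma B t₀] (Y v)) (hY2 : ∀ v, MemLp (Y v) 2 μ) {V : ℝ}
    (hV1 : 1 ≤ V) (hV : ∀ v, ∫ ω, Y v ω ^ 2 ∂μ ≤ V) {s t : ℝ} (hs : t₀ ≤ s) (hst : s ≤ t)
    (ht : t ≤ t₀ + ρ ^ 2) {G : Set Ω} (hG : MeasurableSet[pastSigma B s] G) :
    ∫ ω in G, frozenEM a b i₀ B Y t₀ t ω ^ 2 ∂μ
      ≤ ∫ ω in G, frozenEM a b i₀ B Y t₀ s ω ^ 2 ∂μ + (t - s) * ((5 * κ * (1 + r) + q) * V) := by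
  have hYs : ∀ v, Measurable[pastSigma B s] (Y v) :=
    fun v => (hYm v).mono (pastSigma_mono B hs) le_rfl
  have hY0 : ∀ v, Measurable (Y v) := fun v => (hYm v).mono (pastSigma_le hB.measurable _) le_rfl
  have hs0 : 0 ≤ s := ht₀.trans hs
  have hBs := measurable_pastSigma B hs0 le_rfl
  have hBt₀ := measurable_pastSigma B ht₀ hs
  obtain ⟨hD2, hDmean, hDsq⟩ := hB.moments hs0 hst
  obtain ⟨hW2, -, hWsq⟩ := hB.moments ht₀ hs
  obtain ⟨hκ, hq⟩ := hc.nonneg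
  have hPi : Integrable (fun ω => κ * (1 + ∑ v, Y v ω ^ 2)) μ :=
    ((integrable_const 1).add (integrable_finsetSum _ fun v _ => (hY2 v).integrable_sq)).const_mul κ
  have hPint : ∫ ω, κ * (1 + ∑ v, Y v ω ^ 2) ∂μ ≤ κ * ((1 + r) * V) := by
    rw [integral_const_mul, integral_add (integrable_const 1)
      (integrable_finsetSum _ fun v _ => (hY2 v).integrable_sq),
      integral_finsetSum _ fun v _ => (hY2 v).integrable_sq]
    gcongr
    have : ∑ v, ∫ ω, Y v ω ^ 2 ∂μ ≤ ∑ _v : Fin r, V := Finset.sum_le_sum fun v _ => hV v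
    simp only [Finset.sum_const, Finset.card_univ, Fintype.card_fin, nsmul_eq_mul] at this
    simp only [integral_const, probReal_univ, smul_eq_mul]
    linarith
  have hstep := setIntegral_sq_step_le (pastSigma_le hB.measurable s) (X := Y i₀)
    (a := fun ω => a fun v => Y v ω) (b := fun ω => b (Y i₀ ω))
    (W := fun ω => B s ω - B t₀ ω) (D := fun ω => B t ω - B s ω) (s := s - t₀) (δ := t - s)
    (hYs i₀) (hc.measurable_drift.comp (@measurable_pi_lambda _ _ _ (pastSigma B s) _ _ hYs))
    (hc.measurable_diff.comp (hYs i₀)) (hBs.sub hBt₀)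
    ((hB.measurable t).sub (hB.measurable s)) (hY2 i₀) (hc.memLp_drift hY0 hY2)
    (fun ω => hc.abs_diff_le _) hW2 hD2 hPi (hB.indep s t hs0 hst) hDmean hDsq
    (hWsq.le.trans (by linarith)) (sub_nonneg.2 hs) (sub_nonneg.2 hst) (by linarith) hc.pos
    hc.le_one hq (fun ω => hc.sq_diff_le _) (fun ω => hc.sq_drift_le _)
    (fun ω => hc.coercive fun v => Y v ω) hG
  have e : ∀ ω, frozenEM a b i₀ B Y t₀ t ω = Y i₀ ω + (a fun v => Y v ω) * (s - t₀ + (t - s))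
      + b (Y i₀ ω) * (B s ω - B t₀ ω + (B t ω - B s ω)) := by
    intro ω
    simp only [frozenEM]
    ring
  simp only [e]
  refine hstep.trans ?_
  simp only [frozenEM]
  have : 5 * ∫ ω, κ * (1 + ∑ v, Y v ω ^ 2) ∂μ + q ≤ (5 * κ * (1 + r) + q) * V := by
    nlinarith
  gcongr

/-- Measurability and a discrete Grönwall bound for the second moments of a delay
Euler–Maruyama scheme. -/
theorem delayEM_moments (hB : HasIndepGaussianIncrements B μ)
    (hc : TruncatedCoeffBounds a b i₀ ρ κ q amax bmax) {k : Fin r → ℕ} {kmax : ℕ}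
    (hk : ∀ v, k v ≤ kmax) {X : ℤ → Ω → ℝ} {x₀ : ℤ → ℝ} {S : ℝ}
    (hinit : ∀ j : ℤ, -(kmax : ℤ) ≤ j → j ≤ 0 → ∀ ω, X j ω = x₀ j)
    (hS : ∀ j : ℤ, -(kmax : ℤ) ≤ j → j ≤ 0 → x₀ j ^ 2 ≤ S) {M : ℕ}
    (hrec : ∀ j : ℕ, j < M → ∀ ω, X ((j : ℤ) + 1) ω =
      frozenEM a b i₀ B (fun v => X ((j : ℤ) - k v)) (j * ρ ^ 2) ((j + 1) * ρ ^ 2) ω) :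
    ∀ j : ℕ, j ≤ M → ∀ i : ℤ, -(kmax : ℤ) ≤ i → i ≤ j →
      Measurable[pastSigma B (j * ρ ^ 2)] (X i) ∧ MemLp (X i) 2 μ ∧
        ∫ ω, X i ω ^ 2 ∂μ ≤ (1 + S) * (1 + (5 * κ * (1 + r) + q) * ρ ^ 2) ^ j := by
  obtain ⟨hκ, hq⟩ := hc.nonneg
  set c := 5 * κ * (1 + r) + q with hcdef
  have hc0 : 0 ≤ c := by positivity
  have hS0 : 0 ≤ S := (sq_nonneg _).trans (hS 0 (by simp) le_rfl)
  have h1c : 1 ≤ 1 + c * ρ ^ 2 := by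
    have : 0 ≤ c * ρ ^ 2 := by positivity
    linarith
  intro j
  induction j with
  | zero =>
    intro _ i hi hi0
    have hX : X i = fun _ => x₀ i := funext (hinit i hi (by simpa using hi0))
    rw [hX]
    refine ⟨measurable_const, memLp_const _, ?_⟩
    have := hS i hi (by simpa using hi0)
    simp
    linarith
  | succ j ih =>
    intro hj i hi hij
    have ih := ih (by omega)
    have hle : (j : ℝ) * ρ ^ 2 ≤ ((j + 1 : ℕ) : ℝ) * ρ ^ 2 := by gcongr; simp
    rcases Int.le_iff_lt_or_eq.1 hij with h | h
    · obtain ⟨h1, h2, h3⟩ := ih i hi (by push_cast at h; omega)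
      refine ⟨h1.mono (pastSigma_mono B hle) le_rfl, h2, h3.trans ?_⟩
      gcongr
      omega
    · have hY := fun v => ih ((j : ℤ) - k v) (by have := hk v; omega) (by omega)
      have ht₀ : (0 : ℝ) ≤ j * ρ ^ 2 := by positivity
      have hXi : X i = frozenEM a b i₀ B (fun v => X ((j : ℤ) - k v)) (j * ρ ^ 2)
          ((j + 1) * ρ ^ 2) := by
        rw [h]; push_cast; exact funext (hrec j (by omega))
      have hle' : (j : ℝ) * ρ ^ 2 ≤ (j + 1) * ρ ^ 2 := by simpa using hle
      have hm := frozenEM_measurable_memLp hB hc ht₀ (fun v => (hY v).1)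
        (fun v => (hY v).2.1) hle'
      rw [hXi]
      refine ⟨by rw [Nat.cast_succ]; exact hm.1, hm.2, ?_⟩
      have hV1 : 1 ≤ (1 + S) * (1 + c * ρ ^ 2) ^ j := by
        have := one_le_pow₀ h1c (n := j)
        nlinarith
      have h := setIntegral_sq_frozenEM_le hB hc ht₀ (fun v => (hY v).1)
        (fun v => (hY v).2.1) hV1 (fun v => (hY v).2.2) le_rfl hle' (by linarith)
        (G := Set.univ) MeasurableSet.univ
      simp only [Measure.restrict_univ] at h
      refine h.trans ?_
      have h4 : ∫ ω, frozenEM a b i₀ B (fun v => X ((j : ℤ) - k v)) (j * ρ ^ 2)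
          (j * ρ ^ 2) ω ^ 2 ∂μ ≤ (1 + S) * (1 + c * ρ ^ 2) ^ j := by
        simpa [frozenEM] using (hY i₀).2.2
      rw [← hcdef]
      rw [pow_succ (1 + c * ρ ^ 2)]
      linear_combination h4

end FrozenStep

theorem continuous_of_polynomial_holder {f : ℝ → ℝ} {L l s : ℝ} (hl : 0 ≤ l) (hs : 0 < s)
    (h : ∀ x y : ℝ, |f x - f y| ≤ L * (1 + |x| ^ l + |y| ^ l) * |x - y| ^ s) : Continuous f := by
  rw [continuous_iff_continuousAt]
  intro x
  have hc : Continuous fun y : ℝ => L * (1 + |y| ^ l + |x| ^ l) * |y - x| ^ s := by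
    refine (continuous_const.mul ((continuous_const.add ?_).add continuous_const)).mul ?_
    · exact continuous_abs.rpow_const fun _ => Or.inr hl
    · exact (continuous_abs.comp (continuous_id.sub continuous_const)).rpow_const
        fun _ => Or.inr hs.le
  have hlim := hc.tendsto x
  simp only [sub_self, abs_zero, Real.zero_rpow hs.ne', mul_zero] at hlim
  refine tendsto_iff_dist_tendsto_zero.2 (squeeze_zero (fun _ => dist_nonneg) (fun y => ?_) hlim)
  exact h y x

theorem continuous_of_abs_sub_le_sum {r : ℕ} {f : (Fin r → ℝ) → ℝ} {L : ℝ}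
    (h : ∀ m n : Fin r → ℝ, |f m - f n| ≤ L * ∑ i, |m i - n i|) : Continuous f := by
  rw [continuous_iff_continuousAt]
  intro x
  have hc : Continuous fun y : Fin r → ℝ => L * ∑ i, |y i - x i| := by fun_prop
  have hlim := hc.tendsto x
  simp only [sub_self, abs_zero, Finset.sum_const_zero, mul_zero] at hlim
  exact tendsto_iff_dist_tendsto_zero.2
    (squeeze_zero (fun _ => dist_nonneg) (fun y => h y x) hlim)

section Truncation

variable {p : ℝ → ℝ} {w : ℝ}

theorem abs_truncation_le (hw : 1 ≤ w)
    (hp : ∀ x, p x = if x = 0 then 0 else min |x| w * (x / |x|)) (x : ℝ) : |p x| ≤ w := by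
  rw [hp]
  split_ifs with hx
  · simpa using zero_le_one.trans hw
  · have hx' : |x| ≠ 0 := abs_ne_zero.2 hx
    rw [abs_mul, abs_div, abs_abs, div_self hx', mul_one, abs_of_nonneg (by positivity)]
    exact min_le_right _ _

theorem measurable_truncation
    (hp : ∀ x, p x = if x = 0 then 0 else min |x| w * (x / |x|)) : Measurable p := by
  rw [funext hp]
  refine Measurable.ite (measurableSet_singleton 0) measurable_const ?_
  exact (measurable_id.abs.min measurable_const).mul (measurable_id.div measurable_id.abs)

theorem truncation_coercive (hw : 1 ≤ w)
    (hp : ∀ x, p x = if x = 0 then 0 else min |x| w * (x / |x|)) {f g : ℝ → ℝ} {L : ℝ}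
    (hL : 0 ≤ L) (h : ∀ x, x * f x + 1 / 2 * g x ^ 2 ≤ L * (1 + x ^ 2)) (x : ℝ) :
    x * f (p x) + 1 / 2 * g (p x) ^ 2 ≤ 2 * L * (1 + x ^ 2) := by
  have hLx : L * (1 + x ^ 2) ≤ 2 * L * (1 + x ^ 2) := by
    have : 0 ≤ L * (1 + x ^ 2) := by positivity
    linarith
  rcases le_or_gt |x| w with hxw | hxw
  · have hpx : p x = x := by
      rw [hp]
      split_ifs with hx
      · exact hx.symm
      · have hx' : |x| ≠ 0 := abs_ne_zero.2 hx
        rw [min_eq_left hxw]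
        field_simp
    rw [hpx]
    exact (h x).trans hLx
  · have hw0 : 0 < w := by linarith
    have hx0 : 0 < |x| := hw0.trans hxw
    have hx : x ≠ 0 := abs_pos.1 hx0
    have hpx : p x = w * (x / |x|) := by rw [hp, if_neg hx, min_eq_right hxw.le]
    have hpsq : p x ^ 2 = w ^ 2 := by
      rw [hpx, mul_pow, div_pow, sq_abs, div_self (pow_ne_zero 2 hx), mul_one]
    have hxp : x = |x| / w * p x := by rw [hpx]; field_simp
    have hF : 1 ≤ |x| / w := by rw [le_div_iff₀ hw0]; linarith
    have h1 := mul_le_mul_of_nonneg_left (h (p x)) (by linarith : 0 ≤ |x| / w)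
    have h2 : x * f (p x) + 1 / 2 * g (p x) ^ 2
        ≤ |x| / w * (p x * f (p x) + 1 / 2 * g (p x) ^ 2) := by
      have e : x * f (p x) = |x| / w * p x * f (p x) := by rw [← hxp]
      have : 1 / 2 * g (p x) ^ 2 ≤ |x| / w * (1 / 2 * g (p x) ^ 2) :=
        le_mul_of_one_le_left (by positivity) hF
      rw [e]
      linarith
    have h3 : |x| / w * (1 + w ^ 2) ≤ 2 * (1 + x ^ 2) := by
      have e : |x| / w * (1 + w ^ 2) = |x| / w + |x| * w := by field_simp
      have e1 : |x| / w ≤ |x| := div_le_self hx0.le hw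
      have e2 : |x| * w ≤ |x| * |x| := by gcongr
      rw [e]
      rw [abs_mul_abs_self] at e2
      nlinarith [sq_abs x, sq_nonneg (|x| - 1)]
    rw [hpsq] at h1
    have h4 := mul_le_mul_of_nonneg_left h3 hL
    linarith

theorem truncatedCoeffBounds {r : ℕ} (i₀ : Fin r) (hw : 1 ≤ w)
    (hp : ∀ x, p x = if x = 0 then 0 else min |x| w * (x / |x|)) {f g : ℝ → ℝ}
    {f₃ : (Fin r → ℝ) → ℝ} {L L₁ L₀ ρ M : ℝ} (hL : 0 ≤ L) (hL₁ : 0 ≤ L₁) (hρ : 0 < ρ)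
    (hρ1 : ρ ≤ 1) (hM : 0 ≤ M) (hMρ : M ^ 2 * ρ ≤ L₀ ^ 2) (hf : Measurable f) (hg : Measurable g)
    (hfM : ∀ x, |x| ≤ w → |f x| ≤ 2 * M) (hgM : ∀ x, |x| ≤ w → |g x| ≤ M)
    (h : ∀ x, x * f x + 1 / 2 * g x ^ 2 ≤ L * (1 + x ^ 2))
    (hf₃ : ∀ m n : Fin r → ℝ, |f₃ m - f₃ n| ≤ L₁ * ∑ i, |m i - n i|) :
    TruncatedCoeffBounds (fun m => f (p (m i₀)) + f₃ m) (fun x => g (p x)) i₀ ρ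
      (4 * L + 1 + 8 * L₀ ^ 2 + 4 * f₃ 0 ^ 2 + 4 * L₁ ^ 2 * r) (L₀ ^ 2)
      (2 * M + |f₃ 0| + L₁) M := by
  have hpw := abs_truncation_le hw hp
  have hpm := measurable_truncation hp
  have hlin : ∀ m : Fin r → ℝ, |f₃ m| ≤ |f₃ 0| + L₁ * ∑ i, |m i| := by
    intro m
    have h1 := hf₃ m 0
    simp only [Pi.zero_apply, sub_zero] at h1
    have h2 := abs_sub_abs_le_abs_sub (f₃ m) (f₃ 0)
    linarith
  have hsq : ∀ m : Fin r → ℝ, f₃ m ^ 2 ≤ 2 * f₃ 0 ^ 2 + 2 * L₁ ^ 2 * r * ∑ i, m i ^ 2 := by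
    intro m
    have h1 : f₃ m ^ 2 ≤ (|f₃ 0| + L₁ * ∑ i, |m i|) ^ 2 := by
      rw [← sq_abs (f₃ m)]
      exact pow_le_pow_left₀ (abs_nonneg _) (hlin m) 2
    have h2 : (∑ i, |m i|) ^ 2 ≤ r * ∑ i, m i ^ 2 := by
      simpa using sq_sum_le_card_mul_sum_sq (s := Finset.univ) (f := fun i => |m i|)
    have h3 := mul_le_mul_of_nonneg_left h2 (by positivity : 0 ≤ 2 * L₁ ^ 2)
    nlinarith [sq_nonneg (|f₃ 0| - L₁ * ∑ i, |m i|), sq_abs (f₃ 0)]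
  have hsum : ∀ m : Fin r → ℝ, 0 ≤ ∑ i, m i ^ 2 :=
    fun m => Finset.sum_nonneg fun i _ => sq_nonneg _
  have hr : (0 : ℝ) ≤ r := Nat.cast_nonneg r
  refine ⟨hρ, hρ1, ?_, hg.comp hpm, ?_, fun x => hgM _ (hpw x), ?_, ?_, ?_⟩
  · exact (hf.comp (hpm.comp (measurable_pi_apply i₀))).add
      (continuous_of_abs_sub_le_sum hf₃).measurable
  · intro m
    have h1 := hfM _ (hpw (m i₀))
    have h2 := hlin m
    have h3 := abs_add_le (f (p (m i₀))) (f₃ m)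
    have h4 : 0 ≤ ∑ i, |m i| := Finset.sum_nonneg fun i _ => abs_nonneg _
    nlinarith [mul_nonneg hM h4, mul_nonneg (abs_nonneg (f₃ 0)) h4]
  · intro x
    have h1 : g (p x) ^ 2 ≤ M ^ 2 := by
      rw [← sq_abs]
      exact pow_le_pow_left₀ (abs_nonneg _) (hgM _ (hpw x)) 2
    exact (mul_le_mul_of_nonneg_right h1 hρ.le).trans hMρ
  · intro m
    have h1 : f (p (m i₀)) ^ 2 ≤ (2 * M) ^ 2 := by
      rw [← sq_abs]
      exact pow_le_pow_left₀ (abs_nonneg _) (hfM _ (hpw _)) 2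
    have h2 : (f (p (m i₀)) + f₃ m) ^ 2 ≤ 2 * (2 * M) ^ 2 + 2 * f₃ m ^ 2 := by
      nlinarith [sq_nonneg (f (p (m i₀)) - f₃ m)]
    have h3 := mul_le_mul_of_nonneg_right h2 hρ.le
    have h4 : f₃ m ^ 2 * ρ ≤ f₃ m ^ 2 := mul_le_of_le_one_right (sq_nonneg _) hρ1
    have h5 := hsq m
    have h6 : 0 ≤ (4 * L + 1 + 8 * L₀ ^ 2 + 4 * f₃ 0 ^ 2) * ∑ i, m i ^ 2 :=
      mul_nonneg (by positivity) (hsum m)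
    have h7 : 0 ≤ 4 * L₁ ^ 2 * r := by positivity
    linarith
  · intro m
    have h1 := truncation_coercive hw hp hL h (m i₀)
    have h2 := hsq m
    have h3 : m i₀ ^ 2 ≤ ∑ i, m i ^ 2 :=
      Finset.single_le_sum (f := fun i => m i ^ 2) (fun i _ => sq_nonneg _) (Finset.mem_univ i₀)
    have h4 := two_mul_le_add_sq (m i₀) (f₃ m)
    have h5 : 0 ≤ (8 * L₀ ^ 2 + 4 * f₃ 0 ^ 2 + 2 * L₁ ^ 2 * r) * ∑ i, m i ^ 2 :=
      mul_nonneg (by positivity) (hsum m)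
    have h7 : 0 ≤ 4 * L₁ ^ 2 * r := by positivity
    have h8 : 4 * L * (1 + m i₀ ^ 2) ≤ 4 * L * (1 + ∑ i, m i ^ 2) := by gcongr
    nlinarith [sq_nonneg L₀, sq_nonneg (f₃ 0)]

end Truncation

/-- For a process with piecewise continuous paths, a uniform bound for the level exceedance
along all refinements of a grid carries over to the exceedance on the whole interval. -/
theorem measure_exists_ge_le_of_grid {Ω : Type*} [MeasurableSpace Ω] {μ : Measure Ω}
    {Z : ℝ → Ω → ℝ} {M : ℕ} (hM : 0 < M) {Δ : ℝ} (hΔ : 0 < Δ)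
    (hcont : ∀ j < M, ∀ ω, ContinuousOn (fun t => Z t ω) (Set.Icc (j * Δ) ((j + 1) * Δ)))
    {lam K : ℝ} (hK : lam < K) {p : ENNReal}
    (hp : ∀ N : ℕ, 0 < N → μ {ω | ∃ i ≤ M * N, lam ≤ Z (i * (Δ / N)) ω} ≤ p) :
    μ {ω | ∃ t ∈ Set.Icc (0 : ℝ) (M * Δ), K ≤ Z t ω} ≤ p := by
  set E : ℕ → Set Ω := fun N => {ω | ∃ i ≤ M * (N + 1), lam ≤ Z (i * (Δ / (N + 1 : ℕ))) ω}
  set A : ℕ → Set Ω := fun n => {ω | ∀ N ≥ n, ω ∈ E N}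
  have hA : Monotone A := fun n n' hn ω hω N hN => hω N (hn.trans hN)
  have hsub : {ω | ∃ t ∈ Set.Icc (0 : ℝ) (M * Δ), K ≤ Z t ω} ⊆ ⋃ n, A n := by
    rintro ω ⟨t, ⟨ht0, htM⟩, hKt⟩
    obtain ⟨j, hj, htj⟩ : ∃ j < M, t ∈ Set.Icc ((j : ℝ) * Δ) ((j + 1) * Δ) := by
      rcases htM.lt_or_eq with h | h
      · refine ⟨⌊t / Δ⌋₊, (Nat.floor_lt (by positivity)).2 (by rwa [div_lt_iff₀ hΔ]), ?_, ?_⟩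
        · rw [← le_div_iff₀ hΔ]; exact Nat.floor_le (by positivity)
        · rw [← div_le_iff₀ hΔ]; exact (Nat.lt_floor_add_one _).le
      · refine ⟨M - 1, by omega, ?_⟩
        rw [Nat.cast_pred hM, h]
        constructor <;> nlinarith
    set s : ℕ → ℝ := fun N => (⌊t / (Δ / (N + 1 : ℕ))⌋₊ : ℝ) * (Δ / (N + 1 : ℕ)) with hs
    have hδ : ∀ N : ℕ, 0 < Δ / (N + 1 : ℕ) := fun N => by positivity
    have hst : ∀ N, s N ≤ t := fun N => by
      rw [hs]; simp only; rw [← le_div_iff₀ (hδ N)]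
      exact Nat.floor_le (div_nonneg ht0 (hδ N).le)
    have hts : ∀ N, t - Δ / (N + 1 : ℕ) ≤ s N := fun N => by
      have := (div_lt_iff₀ (hδ N)).1 (Nat.lt_floor_add_one (t / (Δ / (N + 1 : ℕ))))
      rw [hs]; simp only; linarith
    have hjs : ∀ N, (j : ℝ) * Δ ≤ s N := fun N => by
      have h1 : j * (N + 1) ≤ ⌊t / (Δ / (N + 1 : ℕ))⌋₊ := by
        refine Nat.le_floor ?_
        rw [le_div_iff₀ (hδ N)]
        refine le_trans (le_of_eq ?_) htj.1
        push_cast; field_simp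
      calc (j : ℝ) * Δ = ((j * (N + 1) : ℕ) : ℝ) * (Δ / (N + 1 : ℕ)) := by push_cast; field_simp
        _ ≤ s N := by rw [hs]; simp only; gcongr
    have hlim : Filter.Tendsto s Filter.atTop (nhds t) := by
      have h0 : Filter.Tendsto (fun N : ℕ => t - Δ / (N + 1 : ℕ)) Filter.atTop (nhds t) := by
        have h1 := (tendsto_const_div_atTop_nhds_zero_nat Δ).comp (Filter.tendsto_add_atTop_nat 1)
        simpa using (tendsto_const_nhds (x := t)).sub h1
      exact tendsto_of_tendsto_of_tendsto_of_le_of_le h0 tendsto_const_nhds hts hst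
    have hlim' := ((hcont j hj ω) t htj).tendsto.comp
      (tendsto_nhdsWithin_iff.2 ⟨hlim, Filter.Eventually.of_forall
        fun N => ⟨hjs N, (hst N).trans htj.2⟩⟩)
    obtain ⟨n, hn⟩ := Filter.eventually_atTop.1 (hlim'.eventually_const_lt (hK.trans_le hKt))
    refine Set.mem_iUnion.2 ⟨n, fun N hN => ⟨⌊t / (Δ / (N + 1 : ℕ))⌋₊, ?_, (hn N hN).le⟩⟩
    refine Nat.floor_le_of_le ?_
    rw [div_le_iff₀ (hδ N)]
    refine htM.trans (le_of_eq ?_)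
    push_cast; field_simp
  refine (measure_mono hsub).trans ?_
  rw [hA.measure_iUnion]
  exact iSup_le fun n => (measure_mono fun ω (hω : ω ∈ A n) => hω n le_rfl).trans (hp (n + 1) n.succ_pos)

/-- Exit-time bound for the continuous delay Euler–Maruyama scheme with step size `ρ ^ 2`. -/
theorem delayEM_measure_exit_le {Ω : Type*} [MeasurableSpace Ω] {μ : Measure Ω}
    [IsProbabilityMeasure μ] {B : ℝ → Ω → ℝ} {r : ℕ} {a : (Fin r → ℝ) → ℝ} {b : ℝ → ℝ} {i₀ : Fin r}
    {ρ κ q amax bmax : ℝ} (hB : HasIndepGaussianIncrements B μ)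
    (hBcont : ∀ ω, Continuous fun t => B t ω)
    (hc : TruncatedCoeffBounds a b i₀ ρ κ q amax bmax) {k : Fin r → ℕ} {kmax : ℕ}
    (hk0 : k i₀ = 0) (hk : ∀ v, k v ≤ kmax) {X : ℤ → Ω → ℝ} {x₀ : ℤ → ℝ} {S : ℝ}
    (hinit : ∀ j : ℤ, -(kmax : ℤ) ≤ j → j ≤ 0 → ∀ ω, X j ω = x₀ j)
    (hS : ∀ j : ℤ, -(kmax : ℤ) ≤ j → j ≤ 0 → x₀ j ^ 2 ≤ S) {M : ℕ} (hM : 0 < M)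
    (hrec : ∀ j : ℕ, j < M → ∀ ω, X ((j : ℤ) + 1) ω =
      frozenEM a b i₀ B (fun v => X ((j : ℤ) - k v)) (j * ρ ^ 2) ((j + 1) * ρ ^ 2) ω)
    {χ : ℝ → Ω → ℝ}
    (hχ : ∀ j : ℕ, j < M → ∀ t ∈ Set.Icc ((j : ℝ) * ρ ^ 2) ((j + 1) * ρ ^ 2), ∀ ω,
      χ t ω = frozenEM a b i₀ B (fun v => X ((j : ℤ) - k v)) (j * ρ ^ 2) t ω)
    {K : ℝ} (hK : 0 < K) :
    μ {ω | ∃ t ∈ Set.Icc (0 : ℝ) (M * ρ ^ 2), K ≤ |χ t ω|} ≤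
      ENNReal.ofReal (4 * (S + M * ρ ^ 2 * ((5 * κ * (1 + r) + q) *
        ((1 + S) * Real.exp ((5 * κ * (1 + r) + q) * (M * ρ ^ 2))))) / K ^ 2) := by
  have hmom := delayEM_moments hB hc hk hinit hS hrec
  obtain ⟨hκ, hq⟩ := hc.nonneg
  set c := 5 * κ * (1 + r) + q with hcdef
  have hc0 : 0 ≤ c := by positivity
  have hS0 : 0 ≤ S := (sq_nonneg _).trans (hS 0 (by simp) le_rfl)
  have hρ := hc.pos
  set V := (1 + S) * Real.exp (c * (M * ρ ^ 2)) with hVdef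
  have hV1 : 1 ≤ V := by
    have : 1 ≤ Real.exp (c * (M * ρ ^ 2)) := Real.one_le_exp (by positivity)
    nlinarith
  have hVj : ∀ j : ℕ, j ≤ M → (1 + S) * (1 + c * ρ ^ 2) ^ j ≤ V := by
    intro j hj
    have h1 : (1 + c * ρ ^ 2) ^ j ≤ Real.exp (c * ρ ^ 2) ^ j := by
      gcongr
      have := Real.add_one_le_exp (c * ρ ^ 2)
      linarith
    rw [hVdef]
    gcongr
    refine h1.trans ?_
    rw [← Real.exp_nat_mul, Real.exp_le_exp]
    have : (j : ℝ) ≤ M := by exact_mod_cast hj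
    nlinarith [mul_nonneg hc0 (sq_nonneg ρ)]
  have hY : ∀ j : ℕ, j < M → ∀ v, Measurable[pastSigma B (j * ρ ^ 2)] (X ((j : ℤ) - k v)) ∧
      MemLp (X ((j : ℤ) - k v)) 2 μ ∧ ∫ ω, X ((j : ℤ) - k v) ω ^ 2 ∂μ ≤ V := by
    intro j hj v
    obtain ⟨h1, h2, h3⟩ := hmom j hj.le ((j : ℤ) - k v) (by have := hk v; omega) (by omega)
    exact ⟨h1, h2, h3.trans (hVj j hj.le)⟩
  have hχm : ∀ j : ℕ, j < M → ∀ t ∈ Set.Icc ((j : ℝ) * ρ ^ 2) ((j + 1) * ρ ^ 2),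
      Measurable[pastSigma B t] (χ t) ∧ MemLp (χ t) 2 μ := by
    intro j hj t ht
    rw [funext (hχ j hj t ht)]
    exact frozenEM_measurable_memLp hB hc (by positivity) (fun v => (hY j hj v).1)
      (fun v => (hY j hj v).2.1) ht.1
  have hχ0 : ∫ ω, χ 0 ω ^ 2 ∂μ ≤ S := by
    have h0 : ∀ ω, χ 0 ω = x₀ 0 := by
      intro ω
      have h := hχ 0 hM 0 ⟨by simp, by positivity⟩ ω
      have hX := hinit 0 (by simp) le_rfl ω
      simpa [frozenEM, hk0, hX] using h
    simpa [h0] using hS 0 (by simp) le_rfl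
  have hgrid : ∀ N : ℕ, 0 < N → μ {ω | ∃ i ≤ M * N, (K / 2) ^ 2 ≤ χ (i * (ρ ^ 2 / N)) ω ^ 2} ≤
      ENNReal.ofReal (4 * (S + M * ρ ^ 2 * (c * V)) / K ^ 2) := by
    intro N hN
    have hN' : (0 : ℝ) < N := by exact_mod_cast hN
    have hδ : 0 < ρ ^ 2 / N := by positivity
    have hcell : ∀ n < M * N, n / N < M ∧
        ((n / N : ℕ) : ℝ) * ρ ^ 2 ≤ n * (ρ ^ 2 / N) ∧
        ((n + 1 : ℕ) : ℝ) * (ρ ^ 2 / N) ≤ ((n / N : ℕ) + 1) * ρ ^ 2 := by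
      intro n hn
      refine ⟨(Nat.div_lt_iff_lt_mul hN).2 hn, ?_, ?_⟩
      · have h1 : ((n / N * N : ℕ) : ℝ) ≤ n := by exact_mod_cast Nat.div_mul_le_self n N
        calc ((n / N : ℕ) : ℝ) * ρ ^ 2 = ((n / N * N : ℕ) : ℝ) * (ρ ^ 2 / N) := by
              push_cast; field_simp
          _ ≤ n * (ρ ^ 2 / N) := by gcongr
      · have h1 : ((n + 1 : ℕ) : ℝ) ≤ (((n / N + 1) * N : ℕ) : ℝ) := by
          have h := Nat.lt_div_mul_add hN (a := n)
          exact_mod_cast (by rw [add_mul, one_mul]; exact h : n < (n / N + 1) * N)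
        calc ((n + 1 : ℕ) : ℝ) * (ρ ^ 2 / N)
            ≤ (((n / N + 1) * N : ℕ) : ℝ) * (ρ ^ 2 / N) := by gcongr
          _ = ((n / N : ℕ) + 1) * ρ ^ 2 := by push_cast; field_simp
    have hlt : ∀ n : ℕ, (n : ℝ) * (ρ ^ 2 / N) ≤ ((n + 1 : ℕ) : ℝ) * (ρ ^ 2 / N) := by
      intro n
      gcongr
      simp
    have hZ : ∀ n ≤ M * N, Measurable[pastSigma B (n * (ρ ^ 2 / N))] (χ (n * (ρ ^ 2 / N))) ∧
        MemLp (χ (n * (ρ ^ 2 / N))) 2 μ := by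
      intro n hn
      rcases n with _ | n
      · exact hχm 0 hM _ ⟨by simp, by simp; positivity⟩
      · obtain ⟨h1, h2, h3⟩ := hcell n (by omega)
        exact hχm _ h1 _ ⟨h2.trans (hlt n), h3⟩
    have hmax := mul_measureReal_exists_ge_le (μ := μ) (N := M * N)
      (Z := fun n ω => χ (n * (ρ ^ 2 / N)) ω ^ 2) (F := fun n => pastSigma B (n * (ρ ^ 2 / N)))
      (fun n n' hn => pastSigma_mono B (by gcongr)) (fun n => pastSigma_le hB.measurable _)
      (fun n ω => sq_nonneg _) (fun n hn => (hZ n hn).1.pow_const 2)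
      (fun n hn => (hZ n hn).2.integrable_sq) (c := ρ ^ 2 / N * (c * V)) (by
        intro n hn G hG
        obtain ⟨h1, h2, h3⟩ := hcell n hn
        have h := setIntegral_sq_frozenEM_le hB hc (by positivity) (fun v => (hY _ h1 v).1)
          (fun v => (hY _ h1 v).2.1) hV1 (fun v => (hY _ h1 v).2.2) h2 (hlt n) (by linarith) hG
        simp only [hχ _ h1 _ ⟨h2.trans (hlt n), h3⟩, hχ _ h1 _ ⟨h2, (hlt n).trans h3⟩]
        refine h.trans (le_of_eq ?_)
        push_cast
        ring) ((K / 2) ^ 2)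
    have hreal : μ.real {ω | ∃ i ≤ M * N, (K / 2) ^ 2 ≤ χ (i * (ρ ^ 2 / N)) ω ^ 2}
        ≤ 4 * (S + M * ρ ^ 2 * (c * V)) / K ^ 2 := by
      rw [le_div_iff₀ (by positivity)]
      have e : ((M * N : ℕ) : ℝ) * (ρ ^ 2 / N * (c * V)) = M * ρ ^ 2 * (c * V) := by
        push_cast; field_simp
      simp only [Nat.cast_zero, zero_mul] at hmax
      rw [e] at hmax
      nlinarith
    rw [← ENNReal.ofReal_toReal (measure_ne_top μ _)]
    exact ENNReal.ofReal_le_ofReal hreal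
  have hset : {ω | ∃ t ∈ Set.Icc (0 : ℝ) (M * ρ ^ 2), K ≤ |χ t ω|}
      = {ω | ∃ t ∈ Set.Icc (0 : ℝ) (M * ρ ^ 2), K ^ 2 ≤ χ t ω ^ 2} := by
    ext ω
    simp only [Set.mem_ofPred_eq, sq_le_sq, abs_of_pos hK]
  rw [hset]
  refine measure_exists_ge_le_of_grid (Z := fun t ω => χ t ω ^ 2) hM (by positivity)
    (fun j hj ω => ?_) (by nlinarith : (K / 2) ^ 2 < K ^ 2) hgrid
  refine ContinuousOn.pow (ContinuousOn.congr (Continuous.continuousOn ?_)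
    fun t ht => hχ j hj t ht ω) 2
  have := hBcont ω
  unfold frozenEM
  fun_prop

/-- Tail bound for the exit time of the continuous truncated Euler–Maruyama
approximation (Lemma 3.5): under Assumptions A1–A4 and the conditions on `h`, `Γ`,
there is a constant `C > 0`, independent of `Δ` and `K`, such that for all
admissible `Δ ∈ (0,1]` and all `K > ‖ξ‖`,
`P(sup_{0≤t≤T} |χ(t)| ≥ K) ≤ C/K²`, i.e. the stopping time
`ρ_{Δ,K} = inf{t ∈ [0,T] : |χ(t)| ≥ K}` satisfies `P(ρ_{Δ,K} ≤ T) ≤ C/K²`. -/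
theorem truncatedEM_exit_time_bound
    -- probability space and Brownian motion
    {Ω : Type*} [MeasurableSpace Ω] (μ : Measure Ω) [IsProbabilityMeasure μ]
    (B : ℝ → Ω → ℝ)
    (hB0 : ∀ᵐ ω ∂μ, B 0 ω = 0)
    (hBcont : ∀ ω, Continuous fun t => B t ω)
    (hBmeas : ∀ t, Measurable (B t))
    (hBgauss : ∀ s t : ℝ, 0 ≤ s → s ≤ t →
      Measure.map (fun ω => B t ω - B s ω) μ = gaussianReal 0 (Real.toNNReal (t - s)))
    (hBindep : ∀ s t : ℝ, 0 ≤ s → s ≤ t →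
      IndepFun (fun ω => B t ω - B s ω) (fun ω (u : Set.Icc (0:ℝ) s) => B (u : ℝ) ω) μ)
    -- coefficients
    (r : ℕ) (hr : 0 < r)
    (α₁ α₂ β : ℝ → ℝ) (α₃ : (Fin r → ℝ) → ℝ)
    -- Assumption A1
    (L₁ l₁ η : ℝ) (hL₁ : 0 < L₁) (hl₁ : 1 ≤ l₁) (hη : η ∈ Set.Ioo (0 : ℝ) 1)
    (hA1a : ∀ x y : ℝ, |α₁ x - α₁ y| ≤ L₁ * (1 + |x| ^ l₁ + |y| ^ l₁) * |x - y| ^ η)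
    (hA1b : ∀ x y : ℝ, (x - y) * (α₂ x - α₂ y) ≤ L₁ * |x - y| ^ 2)
    (hA1c : ∀ m n : Fin r → ℝ, |α₃ m - α₃ n| ≤ L₁ * ∑ i, |m i - n i|)
    (hα₁cont : Continuous α₁)
    (hα₁anti : ∀ x y : ℝ, x ≤ y → α₁ y ≤ α₁ x)
    -- Assumption A2
    (Lbar₂ pp : ℝ) (hLbar₂ : 0 < Lbar₂) (hpp : 2 ≤ pp)
    (hA2 : ∀ x : ℝ, x * (α₁ x + α₂ x) + (pp - 1) / 2 * |β x| ^ 2 ≤ Lbar₂ * (1 + x ^ 2))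
    -- Assumption A3
    (L₃ σ l₂ l₃ : ℝ) (hL₃ : 0 < L₃) (hσ : σ ∈ Set.Ico (1/2 : ℝ) 1)
    (hl₂ : 1 ≤ l₂) (hl₃ : 1 ≤ l₃)
    (hA3a : ∀ x y : ℝ, |α₂ x - α₂ y| ≤ L₃ * (1 + |x| ^ l₂ + |y| ^ l₂) * |x - y|)
    (hA3b : ∀ x y : ℝ, |β x - β y| ≤ L₃ * (1 + |x| ^ l₃ + |y| ^ l₃) * |x - y| ^ σ)
    -- delays and initial data (Assumption A4)
    (τ : Fin r → ℝ) (τmax : ℝ)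
    (hτ0 : τ ⟨0, hr⟩ = 0) (hτmono : StrictMono τ)
    (hτtop : τ ⟨r - 1, by omega⟩ = τmax)
    (ξ : ℝ → ℝ) (L₄ γ : ℝ) (hL₄ : 0 < L₄) (hγ : γ ∈ Set.Ioc (0 : ℝ) 1)
    (hA4 : ∀ s ∈ Set.Icc (-τmax) (0:ℝ), ∀ t ∈ Set.Icc (-τmax) (0:ℝ),
      |ξ t - ξ s| ≤ L₄ * |t - s| ^ γ)
    -- truncation data
    (h : ℝ → ℝ)
    (hmono : StrictMonoOn h (Set.Ioi (0 : ℝ)))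
    (hcont : ContinuousOn h (Set.Ioi (0 : ℝ)))
    (htop : Filter.Tendsto h Filter.atTop Filter.atTop)
    (hbound : ∀ w : ℝ, 1 ≤ w → ∀ x : ℝ, |x| ≤ w →
      max (max |α₁ x| |α₂ x|) |β x| ≤ h w)
    (hinv : ℝ → ℝ)
    (hinv_spec : ∀ y : ℝ, h 1 ≤ y → 1 ≤ hinv y ∧ h (hinv y) = y)
    (Γ : ℝ → ℝ) (L₀ : ℝ)
    (hΓanti : StrictAntiOn Γ (Set.Ioc (0 : ℝ) 1))
    (hΓtop : Filter.Tendsto Γ (nhdsWithin 0 (Set.Ioi (0:ℝ))) Filter.atTop)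
    (hΓle : ∀ Δ ∈ Set.Ioc (0 : ℝ) 1, Δ ^ ((1:ℝ)/4) * Γ Δ ≤ L₀)
    (hΓge : ∀ Δ ∈ Set.Ioc (0 : ℝ) 1, h 1 ≤ Γ Δ)
    (π : ℝ → ℝ → ℝ)
    (hπ : ∀ Δ x : ℝ, π Δ x =
      if x = 0 then 0 else min |x| (hinv (Γ Δ)) * (x / |x|))
    -- horizon
    (T : ℝ) (hT : 0 < T) :
    ∃ C > (0 : ℝ),
      ∀ Δ ∈ Set.Ioc (0 : ℝ) 1, ∀ MT : ℕ, 0 < MT → Δ = T / MT →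
      ∀ k : Fin r → ℕ, (∀ v : Fin r, τ v = (k v : ℝ) * Δ) →
      ∀ X : ℤ → Ω → ℝ, ∀ χ : ℝ → Ω → ℝ,
        -- initial values of the scheme
        (∀ j : ℤ, -((k ⟨r - 1, by omega⟩ : ℕ) : ℤ) ≤ j → j ≤ 0 →
          ∀ ω, X j ω = ξ ((j : ℝ) * Δ)) →
        -- discrete truncated EM recursion
        (∀ j : ℕ, j < MT → ∀ ω, X ((j : ℤ) + 1) ω =
          X (j : ℤ) ω
            + (α₁ (π Δ (X (j : ℤ) ω)) + α₂ (π Δ (X (j : ℤ) ω))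
                + α₃ (fun v => X ((j : ℤ) - (k v : ℤ)) ω)) * Δ
            + β (π Δ (X (j : ℤ) ω)) * (B (((j : ℝ) + 1) * Δ) ω - B ((j : ℝ) * Δ) ω)) →
        -- continuous version of the scheme
        (∀ j : ℕ, j < MT → ∀ t ∈ Set.Icc ((j : ℝ) * Δ) (((j : ℝ) + 1) * Δ), ∀ ω,
          χ t ω = X (j : ℤ) ω
            + (α₁ (π Δ (X (j : ℤ) ω)) + α₂ (π Δ (X (j : ℤ) ω))
                + α₃ (fun v => X ((j : ℤ) - (k v : ℤ)) ω)) * (t - (j : ℝ) * Δ)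
            + β (π Δ (X (j : ℤ) ω)) * (B t ω - B ((j : ℝ) * Δ) ω)) →
        ∀ K : ℝ, (⨆ θ : Set.Icc (-τmax) (0 : ℝ), |ξ (θ : ℝ)|) < K →
          μ {ω | ∃ t ∈ Set.Icc (0 : ℝ) T, K ≤ |χ t ω|} ≤ ENNReal.ofReal (C / K ^ 2) := by
  have hB : HasIndepGaussianIncrements B μ := ⟨hBmeas, hBgauss, fun s t hs hst =>
    (IndepFun_iff_Indep _ _ _).1 (hBindep s t hs hst)⟩
  have hα₂cont : Continuous α₂ := continuous_of_polynomial_holder (l := l₂) (s := 1)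
    (by linarith) one_pos (by simpa using hA3a)
  have hβcont : Continuous β := continuous_of_polynomial_holder (by linarith)
    (by linarith [hσ.1]) hA3b
  set i₀ : Fin r := ⟨0, hr⟩ with hi₀
  have hτle : ∀ v, τ v ≤ τmax := by
    intro v
    rw [← hτtop]
    exact hτmono.monotone (Fin.mk_le_mk.2 (by omega) : v ≤ ⟨r - 1, by omega⟩)
  have hτmax : 0 ≤ τmax := hτ0 ▸ hτle i₀
  set S := (|ξ 0| + L₄ * τmax ^ γ) ^ 2 with hSdef
  have hξ : ∀ t ∈ Set.Icc (-τmax) (0 : ℝ), ξ t ^ 2 ≤ S := by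
    intro t ht
    have h1 := hA4 0 ⟨by linarith, le_rfl⟩ t ht
    have h2 : |t - 0| ^ γ ≤ τmax ^ γ := by
      refine Real.rpow_le_rpow (abs_nonneg _) ?_ hγ.1.le
      rw [sub_zero, abs_of_nonpos ht.2]
      linarith [ht.1]
    have h3 := abs_sub_abs_le_abs_sub (ξ t) (ξ 0)
    have h4 := mul_le_mul_of_nonneg_left h2 hL₄.le
    rw [← sq_abs (ξ t)]
    exact pow_le_pow_left₀ (abs_nonneg _) (by linarith) 2
  set κ := 4 * Lbar₂ + 1 + 8 * L₀ ^ 2 + 4 * α₃ 0 ^ 2 + 4 * L₁ ^ 2 * r with hκdef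
  set c := 5 * κ * (1 + r) + L₀ ^ 2 with hcdef
  refine ⟨4 * (S + T * (c * ((1 + S) * Real.exp (c * T)))) + 1, by positivity, ?_⟩
  intro Δ hΔ MT hMT hΔT k hk X χ hinit hrec hχ K hK
  have hK0 : 0 < K := (Real.iSup_nonneg fun _ => abs_nonneg _).trans_lt hK
  have hΔ0 : 0 < Δ := hΔ.1
  have hT' : T = MT * Δ := by
    rw [hΔT]
    field_simp
  set ρ := √Δ with hρdef
  have hρ0 : 0 < ρ := Real.sqrt_pos.2 hΔ0
  have hρsq : ρ ^ 2 = Δ := Real.sq_sqrt hΔ0.le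
  have hρ1 : ρ ≤ 1 := Real.sqrt_le_one.2 hΔ.2
  obtain ⟨hw1, hw⟩ := hinv_spec (Γ Δ) (hΓge Δ hΔ)
  have hb := hbound _ hw1
  rw [hw] at hb
  have hΓ0 : 0 ≤ Γ Δ := (abs_nonneg (β 0)).trans
    ((le_max_right _ _).trans (hb 0 (by simpa using zero_le_one.trans hw1)))
  have hΓρ : Γ Δ ^ 2 * ρ ≤ L₀ ^ 2 := by
    have e : ρ = (Δ ^ ((1 : ℝ) / 4)) ^ 2 := by
      rw [hρdef, Real.sqrt_eq_rpow, ← Real.rpow_natCast, ← Real.rpow_mul hΔ0.le]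
      norm_num
    rw [e, ← mul_pow, mul_comm]
    exact pow_le_pow_left₀ (by positivity) (hΓle Δ hΔ) 2
  have hcoeff := truncatedCoeffBounds (r := r) i₀ hw1 (hπ Δ) (f := fun x => α₁ x + α₂ x)
    (g := β) (f₃ := α₃) hLbar₂.le hL₁.le hρ0 hρ1 hΓ0 hΓρ (hα₁cont.add hα₂cont).measurable
    hβcont.measurable
    (fun x hx => by
      have h1 := (le_max_left _ _).trans ((le_max_left _ _).trans (hb x hx))
      have h2 := (le_max_right _ _).trans ((le_max_left _ _).trans (hb x hx))
      have h3 := abs_add_le (α₁ x) (α₂ x)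
      linarith)
    (fun x hx => (le_max_right _ _).trans (hb x hx))
    (fun x => by
      have h1 := hA2 x
      rw [sq_abs] at h1
      nlinarith [mul_nonneg (sub_nonneg.2 hpp) (sq_nonneg (β x))])
    hA1c
  have hk0 : k i₀ = 0 := by
    have h := hk i₀
    rw [hτ0] at h
    have h' := (mul_eq_zero.1 h.symm).resolve_right hΔ0.ne'
    exact_mod_cast h'
  have hkmax : ((k ⟨r - 1, by omega⟩ : ℕ) : ℝ) * Δ = τmax := by rw [← hk, hτtop]
  have hkle : ∀ v, k v ≤ k ⟨r - 1, by omega⟩ := by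
    intro v
    have h := hτle v
    rw [hk v, ← hkmax] at h
    exact_mod_cast le_of_mul_le_mul_right h hΔ0
  have hmain := delayEM_measure_exit_le hB hBcont hcoeff hk0 hkle
    (x₀ := fun j => ξ (j * Δ)) (S := S) hinit
    (fun j hj hj0 => hξ _ ⟨by
      rw [← hkmax, ← neg_mul]
      gcongr
      exact_mod_cast hj, mul_nonpos_of_nonpos_of_nonneg (by exact_mod_cast hj0) hΔ0.le⟩)
    hMT
    (fun j hj ω => by
      rw [hrec j hj ω, hρsq]
      simp only [frozenEM, hk0, Nat.cast_zero, sub_zero]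
      ring)
    (χ := χ)
    (fun j hj t ht ω => by
      rw [hρsq] at ht ⊢
      rw [hχ j hj t ht ω]
      simp only [frozenEM, hk0, Nat.cast_zero, sub_zero])
    hK0
  rw [hρsq, ← hT'] at hmain
  refine hmain.trans (ENNReal.ofReal_le_ofReal ?_)
  gcongr
  linarith
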